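/- For a finite abelian group $(G,+)$, the isomorphism classes of left braces $(B,+,\cdot)$ whose additive group $(B,+)$ is isomorphic to $G$ are in bijective correspondence with the conjugacy classes of regular subgroups of the holomorph $\operatorname{Hol}(G)$. -/

import Mathlib

/-- A left brace structure on a set `B`: an abelian group operation `+` (with
zero element `zero` and negation `neg`), a group operation `*` (with identity
`one` and inversion `inv`), linked by the relation
`x * (y + z) = x * y - x + x * z`, i.e. `x * (y + z) = (x * y + (-x)) + x * z`. -/
structure LeftBrace (B : Type*) where
  add : B → B → B
  zero : B
  neg : B → B
  mul : B → B → B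
  one : B
  inv : B → B
  add_assoc : ∀ a b c, add (add a b) c = add a (add b c)
  add_comm : ∀ a b, add a b = add b a
  zero_add : ∀ a, add zero a = a
  neg_add_cancel : ∀ a, add (neg a) a = zero
  mul_assoc : ∀ a b c, mul (mul a b) c = mul a (mul b c)
  one_mul : ∀ a, mul one a = a
  mul_one : ∀ a, mul a one = a
  inv_mul_cancel : ∀ a, mul (inv a) a = one
  brace : ∀ x y z, mul x (add y z) = add (add (mul x y) (neg x)) (mul x z)

/-- Two left braces are isomorphic if there is a bijection preserving both
operations. -/
def LeftBrace.Iso {B₁ B₂ : Type*} (L₁ : LeftBrace B₁) (L₂ : LeftBrace B₂) : Prop :=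
  ∃ e : B₁ ≃ B₂, (∀ x y, e (L₁.add x y) = L₂.add (e x) (e y)) ∧
    (∀ x y, e (L₁.mul x y) = L₂.mul (e x) (e y))

/-- The additive group of the left brace `L` is isomorphic to the
(additively written) abelian group `A`. -/
def LeftBrace.AddIso {B : Type*} (L : LeftBrace B) (A : Type*) [AddGroup A] : Prop :=
  ∃ e : B ≃ A, ∀ x y, e (L.add x y) = e x + e y

/-- The multiplicative group of the left brace `L` is isomorphic to the
(additively written) group `A`. -/
def LeftBrace.MulIso {B : Type*} (L : LeftBrace B) (A : Type*) [AddGroup A] : Prop :=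
  ∃ e : B ≃ A, ∀ x y, e (L.mul x y) = e x + e y

/-- The holomorph of an (additive) abelian group `G`: the semidirect product
`G ⋊ Aut(G)` with respect to the natural action of `Aut(G)` on `G`, realized
on the carrier `G × AddAut G` with multiplication
`(g, α) * (h, β) = (g + α h, α * β)`. -/
abbrev Hol (G : Type*) [AddCommGroup G] : Type _ := G × AddAut G

instance Hol.instGroup (G : Type*) [AddCommGroup G] : Group (Hol G) where
  mul p q := (p.1 + p.2 q.1, p.2 + q.2)
  one := (0, 0)
  inv p := (-((-p.2) p.1), -p.2)
  mul_assoc a b c := by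
    refine Prod.ext ?_ ?_
    · show a.1 + a.2 b.1 + (a.2 + b.2) c.1 = a.1 + a.2 (b.1 + b.2 c.1)
      simp [AddAut.add_apply, map_add, add_assoc]
    · exact add_assoc a.2 b.2 c.2
  one_mul a := by
    refine Prod.ext ?_ ?_
    · show (0 : _) + (0 : AddAut _) a.1 = a.1
      simp
    · exact zero_add a.2
  mul_one a := by
    refine Prod.ext ?_ ?_
    · show a.1 + a.2 0 = a.1
      simp
    · exact add_zero a.2
  inv_mul_cancel a := by
    refine Prod.ext ?_ ?_
    · show -((-a.2) a.1) + (-a.2) a.1 = 0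
      simp
    · exact neg_add_cancel a.2

/-- The natural action of the holomorph on `G`: `(g, α) • x = g + α x`. -/
def Hol.smul {G : Type*} [AddCommGroup G] (h : Hol G) (x : G) : G := h.1 + h.2 x

/-- A subgroup `H` of `Hol G` is regular if for every pair `x y : G` there is a
unique `h ∈ H` with `h • x = y`. -/
def Hol.IsRegular {G : Type*} [AddCommGroup G] (H : Subgroup (Hol G)) : Prop :=
  ∀ x y : G, ∃! h : Hol G, h ∈ H ∧ Hol.smul h x = y

/-- Two subgroups are conjugate if some element of the ambient group conjugates
one onto the other. -/
def ConjugateSubgroups {Γ : Type*} [Group Γ] (H₁ H₂ : Subgroup Γ) : Prop :=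
  ∃ g : Γ, H₁.map (MulAut.conj g).toMonoidHom = H₂

namespace LeftBrace

variable {B : Type*} (L : LeftBrace B)

/-- The multiplicative group of a left brace. -/
abbrev mulGroup : Group B :=
  letI : Mul B := ⟨L.mul⟩
  letI : One B := ⟨L.one⟩
  letI : Inv B := ⟨L.inv⟩
  Group.ofLeftAxioms L.mul_assoc L.one_mul L.inv_mul_cancel

theorem mul_inv_cancel (a : B) : L.mul a (L.inv a) = L.one :=
  letI := L.mulGroup
  _root_.mul_inv_cancel a

theorem inv_mul_cancel_left (a b : B) : L.mul (L.inv a) (L.mul a b) = b := by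
  rw [← L.mul_assoc, L.inv_mul_cancel, L.one_mul]

theorem mul_inv_cancel_left (a b : B) : L.mul a (L.mul (L.inv a) b) = b := by
  rw [← L.mul_assoc, L.mul_inv_cancel, L.one_mul]

theorem mul_right_cancel {a b c : B} (h : L.mul a b = L.mul c b) : a = c :=
  letI := L.mulGroup
  _root_.mul_right_cancel h

section AddIso

variable {L} {G : Type*} [AddCommGroup G] {e : B ≃ G}

theorem map_zero (he : ∀ x y, e (L.add x y) = e x + e y) : e L.zero = 0 := by
  have h := he L.zero L.zero
  rw [L.zero_add] at h
  exact left_eq_add.mp h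

theorem map_neg (he : ∀ x y, e (L.add x y) = e x + e y) (x : B) : e (L.neg x) = -e x := by
  have h := he (L.neg x) x
  rw [L.neg_add_cancel, map_zero he] at h
  exact eq_neg_of_add_eq_zero_left h.symm

theorem map_mul_add (he : ∀ x y, e (L.add x y) = e x + e y) (x y z : B) :
    e (L.mul x (L.add y z)) = e (L.mul x y) - e x + e (L.mul x z) := by
  rw [L.brace, he, he, map_neg he, sub_eq_add_neg]

theorem map_one (he : ∀ x y, e (L.add x y) = e x + e y) : e L.one = 0 := by
  have h := map_mul_add he L.one L.zero L.zero
  simpa [L.one_mul, L.zero_add, map_zero he] using h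

theorem map_symm_add (he : ∀ x y, e (L.add x y) = e x + e y) (u v : G) :
    e.symm (u + v) = L.add (e.symm u) (e.symm v) := by
  rw [Equiv.symm_apply_eq, he, e.apply_symm_apply, e.apply_symm_apply]

/-- The automorphism `y ↦ x * y - x` attached to an element `x` of a left brace, transported to `G`
along an isomorphism `e` of the additive groups. -/
def lambda (he : ∀ x y, e (L.add x y) = e x + e y) (x : B) : AddAut G where
  toFun u := e (L.mul x (e.symm u)) - e x
  invFun u := e (L.mul (L.inv x) (e.symm (u + e x)))
  left_inv u := by simp [inv_mul_cancel_left]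
  right_inv u := by simp [mul_inv_cancel_left]
  map_add' u v := by
    rw [map_symm_add he, map_mul_add he]
    abel

theorem lambda_apply (he : ∀ x y, e (L.add x y) = e x + e y) (x : B) (u : G) :
    lambda he x u = e (L.mul x (e.symm u)) - e x := rfl

end AddIso

end LeftBrace

namespace Hol

variable {G : Type*} [AddCommGroup G]

theorem mul_smul (h k : Hol G) (x : G) : smul (h * k) x = smul h (smul k x) := by
  change h.1 + h.2 k.1 + (h.2 + k.2) x = h.1 + h.2 (k.1 + k.2 x)
  simp [AddAut.add_apply, map_add, add_assoc]

theorem one_smul (x : G) : smul (1 : Hol G) x = x := by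
  change (0 : G) + (0 : AddAut G) x = x
  simp

theorem inv_smul_smul (h : Hol G) (x : G) : smul h⁻¹ (smul h x) = x := by
  rw [← mul_smul, inv_mul_cancel, one_smul]

theorem smul_inv_smul (h : Hol G) (x : G) : smul h (smul h⁻¹ x) = x := by
  rw [← mul_smul, mul_inv_cancel, one_smul]

theorem smul_zero (h : Hol G) : smul h 0 = h.1 := by
  simp [smul]

theorem smul_add (h : Hol G) (x y : G) : smul h (x + y) = smul h x - smul h 0 + smul h y := by
  simp only [smul, map_add, map_zero]
  abel

theorem ext_smul {h k : Hol G} (H : ∀ x, smul h x = smul k x) : h = k := by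
  have h₁ : h.1 = k.1 := by simpa only [smul_zero] using H 0
  refine Prod.ext h₁ (AddEquiv.ext fun x => ?_)
  have h₂ := H x
  rw [smul, smul, h₁] at h₂
  exact add_left_cancel h₂

/-- The action of an element of the holomorph as a permutation of `G`. -/
def toPerm (h : Hol G) : G ≃ G where
  toFun := smul h
  invFun := smul h⁻¹
  left_inv := inv_smul_smul h
  right_inv := smul_inv_smul h

theorem toPerm_apply (h : Hol G) (x : G) : toPerm h x = smul h x := rfl

/-- The subgroup of the holomorph induced by left multiplications of a left brace, along a
bijection `e` onto `G`. -/
def mulSubgroup {B : Type*} (L : LeftBrace B) (e : B ≃ G) : Subgroup (Hol G) where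
  carrier := {h | ∃ x, ∀ y, smul h (e y) = e (L.mul x y)}
  mul_mem' := by
    rintro h k ⟨x, hx⟩ ⟨y, hy⟩
    exact ⟨L.mul x y, fun z => by rw [mul_smul, hy, hx, L.mul_assoc]⟩
  one_mem' := ⟨L.one, fun z => by rw [one_smul, L.one_mul]⟩
  inv_mem' := by
    rintro h ⟨x, hx⟩
    refine ⟨L.inv x, fun z => ?_⟩
    conv_lhs => rw [← L.mul_inv_cancel_left x z, ← hx]
    exact inv_smul_smul _ _

theorem isRegular_mulSubgroup {B : Type*} {L : LeftBrace B} {e : B ≃ G}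
    (he : ∀ x y, e (L.add x y) = e x + e y) : IsRegular (mulSubgroup L e) := by
  intro a b
  obtain ⟨a, rfl⟩ := e.surjective a
  obtain ⟨b, rfl⟩ := e.surjective b
  have hx : ∀ y, smul (e (L.mul b (L.inv a)), L.lambda he (L.mul b (L.inv a))) (e y) =
      e (L.mul (L.mul b (L.inv a)) y) := fun y => by
    simp [smul, LeftBrace.lambda_apply]
  refine ⟨_, ⟨⟨_, hx⟩, ?_⟩, ?_⟩
  · rw [hx, L.mul_assoc, L.inv_mul_cancel, L.mul_one]
  · rintro k ⟨⟨x, hk⟩, hab⟩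
    have hxb : x = L.mul b (L.inv a) := by
      apply L.mul_right_cancel (b := a)
      rw [L.mul_assoc, L.inv_mul_cancel, L.mul_one]
      exact e.injective ((hk a).symm.trans hab)
    subst hxb
    refine ext_smul fun u => ?_
    obtain ⟨y, rfl⟩ := e.surjective u
    rw [hk, hx]

namespace IsRegular

variable {H : Subgroup (Hol G)} (hH : IsRegular H)

/-- The element of a regular subgroup that sends `0` to `x`. -/
noncomputable def elt (x : G) : Hol G := (hH 0 x).choose

theorem elt_mem (x : G) : hH.elt x ∈ H := (hH 0 x).choose_spec.1.1

theorem elt_smul_zero (x : G) : smul (hH.elt x) 0 = x := (hH 0 x).choose_spec.1.2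

theorem eq_elt {h : Hol G} (hh : h ∈ H) : h = hH.elt (smul h 0) :=
  (hH 0 (smul h 0)).choose_spec.2 h ⟨hh, rfl⟩

theorem elt_zero : hH.elt 0 = 1 := by
  have h := hH.eq_elt H.one_mem
  rw [one_smul] at h
  exact h.symm

theorem elt_smul (x y : G) : hH.elt (smul (hH.elt x) y) = hH.elt x * hH.elt y := by
  have h := hH.eq_elt (H.mul_mem (hH.elt_mem x) (hH.elt_mem y))
  rw [mul_smul, hH.elt_smul_zero y] at h
  exact h.symm

/-- The left brace on `G` with multiplication transported from a regular subgroup. -/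
noncomputable def leftBrace : LeftBrace G where
  add x y := x + y
  zero := 0
  neg x := -x
  mul x y := smul (hH.elt x) y
  one := 0
  inv x := smul (hH.elt x)⁻¹ 0
  add_assoc := add_assoc
  add_comm := add_comm
  zero_add := zero_add
  neg_add_cancel := neg_add_cancel
  mul_assoc x y z := by rw [hH.elt_smul, mul_smul]
  one_mul x := by rw [hH.elt_zero, one_smul]
  mul_one := hH.elt_smul_zero
  inv_mul_cancel x := by
    rw [← hH.eq_elt (H.inv_mem (hH.elt_mem x))]
    nth_rewrite 2 [← hH.elt_smul_zero x]
    exact inv_smul_smul _ _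
  brace x y z := by rw [smul_add, hH.elt_smul_zero, sub_eq_add_neg]

end IsRegular

end Hol

/-- The bijection `e` from the left brace `L` to `G` is additive and turns the multiplication of `L`
into the action of the subgroup `H` of the holomorph. -/
def LeftBrace.IsRealizedBy {B G : Type*} [AddCommGroup G] (L : LeftBrace B) (H : Subgroup (Hol G))
    (e : B ≃ G) : Prop :=
  (∀ x y, e (L.add x y) = e x + e y) ∧
    ∀ x, ∀ h ∈ H, Hol.smul h 0 = e x → ∀ y, e (L.mul x y) = Hol.smul h (e y)

namespace LeftBrace.IsRealizedBy

variable {B B' G : Type*} [AddCommGroup G] {L : LeftBrace B} {L' : LeftBrace B'}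
  {H H' : Subgroup (Hol G)} {e : B ≃ G} {e' : B' ≃ G}

theorem of_mulSubgroup (he : ∀ x y, e (L.add x y) = e x + e y) :
    L.IsRealizedBy (Hol.mulSubgroup L e) e := by
  refine ⟨he, ?_⟩
  rintro x h ⟨x', hx'⟩ h0 y
  have hxx : x' = x := by
    apply e.injective
    rw [← h0, ← LeftBrace.map_one he, hx', L.mul_one]
  rw [hx', hxx]

theorem of_leftBrace (hH : Hol.IsRegular H) : hH.leftBrace.IsRealizedBy H (Equiv.refl G) := by
  refine ⟨fun _ _ => rfl, fun x h hh h0 y => ?_⟩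
  change Hol.smul (hH.elt x) y = Hol.smul h y
  rw [hH.eq_elt hh, h0, Equiv.refl_apply]

theorem comp_iso (h : L'.IsRealizedBy H e') {f : B ≃ B'}
    (hadd : ∀ x y, f (L.add x y) = L'.add (f x) (f y))
    (hmul : ∀ x y, f (L.mul x y) = L'.mul (f x) (f y)) :
    L.IsRealizedBy H (f.trans e') := by
  refine ⟨fun x y => ?_, fun x k hk h0 y => ?_⟩
  · simp [hadd, h.1]
  · simpa [hmul] using h.2 (f x) k hk h0 (f y)

theorem iso (hH : Hol.IsRegular H) (h : L.IsRealizedBy H e) (h' : L'.IsRealizedBy H e') :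
    L.Iso L' := by
  refine ⟨e.trans e'.symm, fun x y => ?_, fun x y => ?_⟩
  · simp [Equiv.symm_apply_eq, h.1, h'.1]
  · have hx := h.2 x _ (hH.elt_mem (e x)) (hH.elt_smul_zero _) y
    have hx' := h'.2 (e'.symm (e x)) _ (hH.elt_mem (e x)) (by simp [hH.elt_smul_zero])
      (e'.symm (e y))
    simp [Equiv.symm_apply_eq, hx, hx']

theorem conjugate (hH : Hol.IsRegular H) (hH' : Hol.IsRegular H') {e' : B ≃ G}
    (h : L.IsRealizedBy H e) (h' : L.IsRealizedBy H' e') : ConjugateSubgroups H H' := by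
  let β : AddAut G :=
    { e.symm.trans e' with
      map_add' := fun u v => by simp [LeftBrace.map_symm_add h.1, h'.1] }
  let g : Hol G := (0, β)
  have hg : ∀ x, Hol.smul g (e x) = e' x := fun x => by
    change 0 + e' (e.symm (e x)) = e' x
    simp
  have key : ∀ x, g * hH.elt (e x) * g⁻¹ = hH'.elt (e' x) := fun x => by
    rw [mul_inv_eq_iff_eq_mul]
    refine Hol.ext_smul fun u => ?_
    obtain ⟨y, rfl⟩ := e.surjective u
    rw [Hol.mul_smul, Hol.mul_smul, hg, ← h.2 x _ (hH.elt_mem _) (hH.elt_smul_zero _), hg,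
      ← h'.2 x _ (hH'.elt_mem _) (hH'.elt_smul_zero _)]
  refine ⟨g, le_antisymm ?_ ?_⟩
  · rintro _ ⟨k, hk, rfl⟩
    obtain ⟨x, hx⟩ := e.surjective (Hol.smul k 0)
    change g * k * g⁻¹ ∈ H'
    rw [hH.eq_elt hk, ← hx, key]
    exact hH'.elt_mem _
  · intro k hk
    obtain ⟨x, hx⟩ := e'.surjective (Hol.smul k 0)
    rw [hH'.eq_elt hk, ← hx, ← key]
    exact ⟨_, hH.elt_mem _, rfl⟩

theorem exists_of_conjugate (hH : Hol.IsRegular H) (h : L.IsRealizedBy H e)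
    (hc : ConjugateSubgroups H H') : ∃ e' : B ≃ G, L.IsRealizedBy H' e' := by
  obtain ⟨g, rfl⟩ := hc
  let t := hH.elt (Hol.smul g⁻¹ 0)
  have ht : t ∈ H := hH.elt_mem _
  have h0 : Hol.smul (g * t) 0 = 0 := by
    rw [Hol.mul_smul, hH.elt_smul_zero, Hol.smul_inv_smul]
  refine ⟨e.trans (Hol.toPerm (g * t)), fun x y => ?_, ?_⟩
  · simp only [Equiv.trans_apply, Hol.toPerm_apply]
    rw [h.1, Hol.smul_add, h0, sub_zero]
  · rintro x _ ⟨k, hk, rfl⟩ hx y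
    have hconj : (MulAut.conj g).toMonoidHom k = g * t * (t⁻¹ * k * t) * (g * t)⁻¹ := by
      change g * k * g⁻¹ = _
      group
    have hmem : t⁻¹ * k * t ∈ H := H.mul_mem (H.mul_mem (H.inv_mem ht) hk) ht
    have hinv : Hol.smul (g * t)⁻¹ 0 = 0 := by
      conv_lhs => rw [← h0]
      exact Hol.inv_smul_smul _ _
    rw [hconj, Hol.mul_smul, hinv, Hol.mul_smul] at hx
    have hx' := (Hol.toPerm (g * t)).injective hx
    simp only [Equiv.trans_apply, Hol.toPerm_apply]
    rw [hconj, Hol.mul_smul _ (g * t)⁻¹, Hol.inv_smul_smul, Hol.mul_smul (g * t),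
      h.2 x _ hmem hx']

end LeftBrace.IsRealizedBy

/-- For a finite abelian group `G`, the isomorphism classes of left braces
with additive group isomorphic to `G` are in bijective correspondence with the
conjugacy classes of regular subgroups of `Hol G`. -/
theorem braces_biject_with_regular_subgroups (G : Type*) [AddCommGroup G] [Finite G] :
    Nonempty
      ((Quot (fun (L₁ L₂ : {L : LeftBrace G // L.AddIso G}) => L₁.1.Iso L₂.1)) ≃
        (Quot (fun (H₁ H₂ : {H : Subgroup (Hol G) // Hol.IsRegular H}) =>
          ConjugateSubgroups H₁.1 H₂.1))) := by
  have hS : ∀ L : {L : LeftBrace G // L.AddIso G},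
      ∃ H : {H : Subgroup (Hol G) // Hol.IsRegular H}, ∃ e : G ≃ G, L.1.IsRealizedBy H.1 e := by
    rintro ⟨L, e, he⟩
    exact ⟨⟨_, Hol.isRegular_mulSubgroup he⟩, e, .of_mulSubgroup he⟩
  have hB : ∀ H : {H : Subgroup (Hol G) // Hol.IsRegular H},
      ∃ L : {L : LeftBrace G // L.AddIso G}, ∃ e : G ≃ G, L.1.IsRealizedBy H.1 e := fun H =>
    ⟨⟨H.2.leftBrace, Equiv.refl G, fun _ _ => rfl⟩, Equiv.refl G, .of_leftBrace H.2⟩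
  choose S e he using hS
  choose T f hf using hB
  refine ⟨Quot.map S ?_, Quot.map T ?_, ?_, ?_⟩
  · rintro L₁ L₂ ⟨φ, hadd, hmul⟩
    exact (he L₁).conjugate (S L₁).2 (S L₂).2 ((he L₂).comp_iso hadd hmul)
  · intro H₁ H₂ hc
    obtain ⟨e', he'⟩ := (hf H₁).exists_of_conjugate H₁.2 hc
    exact he'.iso H₂.2 (hf H₂)
  · rintro ⟨L⟩
    exact Quot.sound ((hf (S L)).iso (S L).2 (he L))
  · rintro ⟨H⟩
    exact Quot.sound ((he (T H)).conjugate (S (T H)).2 H.2 (hf H))
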